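/- arXiv:1501.07415 — 10 statements merged into one kernel-verified Lean document; each statement's English description precedes it below -/
import Mathlib

section
/- Let Y be a Banach space and let T : ℓ² → ℝ-Banach space Y be an injective bounded linear operator. Define A : ℓ¹ → Y by A x = T x, using that every x ∈ ℓ¹ also lies in ℓ² (since ‖x‖_{ℓ²} ≤ ‖x‖_{ℓ¹}). Then the range A(ℓ¹) is not a closed subset of Y. -/
open scoped ENNReal

noncomputable section

/-- The space `ℓ¹` of absolutely summable real sequences. -/
abbrev ell1 : Type := lp (fun _ : ℕ => ℝ) 1

/-- The space `ℓ²` of square-summable real sequences. -/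
abbrev ell2 : Type := lp (fun _ : ℕ => ℝ) 2

/-- The natural embedding `ℓ¹ → ℓ²` (every `ℓ¹`-sequence is square summable). -/
def incl12 (x : ell1) : ell2 :=
  ⟨(x : ℕ → ℝ), (lp.memℓp x).of_exponent_ge (by norm_num)⟩

theorem coeFn_incl12 (x : ell1) : ⇑(incl12 x) = ⇑x := by
  ext; rfl

theorem norm_incl12_le (x : ell1) : ‖incl12 x‖ ≤ ‖x‖ := by
  refine lp.norm_le_of_forall_sum_le (by norm_num) (norm_nonneg x) fun s => ?_
  have hsum : ∑ i ∈ s, ‖x i‖ ≤ ‖x‖ := by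
    simpa using lp.sum_rpow_le_norm_rpow (p := 1) (by norm_num) x s
  calc ∑ i ∈ s, ‖incl12 x i‖ ^ (2 : ℝ≥0∞).toReal = ∑ i ∈ s, ‖x i‖ ^ 2 := by
        simp [coeFn_incl12]
    _ ≤ (∑ i ∈ s, ‖x i‖) ^ 2 := Finset.sum_sq_le_sq_sum_of_nonneg fun i _ => norm_nonneg (x i)
    _ ≤ ‖x‖ ^ 2 := by gcongr
    _ = ‖x‖ ^ (2 : ℝ≥0∞).toReal := by simp

theorem incl12_injective : Function.Injective incl12 := fun x y h =>
  lp.ext (by rw [← coeFn_incl12 x, h, coeFn_incl12])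

/-- The embedding `ℓ¹ → ℓ²` as a continuous linear map. -/
def incl12CLM : ell1 →L[ℝ] ell2 :=
  LinearMap.mkContinuous
    { toFun := incl12
      map_add' := fun x y => lp.ext (by simp only [coeFn_incl12, lp.coeFn_add])
      map_smul' := fun c x => lp.ext (by
        simp only [coeFn_incl12, lp.coeFn_smul, RingHom.id_apply]) }
    1 fun x => (norm_incl12_le x).trans_eq (one_mul _).symm

/-- The `ℓᵖ` norm of the indicator sequence of `{0, …, n - 1}`, raised to the power `p`, is `n`. -/
theorem norm_sum_single_one_rpow {p : ℝ≥0∞} (hp : 0 < p.toReal) (n : ℕ) :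
    ‖∑ i ∈ Finset.range n, lp.single (E := fun _ : ℕ => ℝ) p i 1‖ ^ p.toReal = n := by
  simpa using lp.norm_sum_single hp (fun _ : ℕ => (1 : ℝ)) (Finset.range n)

theorem incl12_single (i : ℕ) (a : ℝ) :
    incl12 (lp.single 1 i a) = lp.single 2 i a :=
  lp.ext (by rw [coeFn_incl12, lp.coeFn_single, lp.coeFn_single])

/-- The `ℓ¹` norm is not dominated by any multiple of the `ℓ²` norm. -/
theorem not_forall_norm_le_mul_norm_incl12 (C : ℝ) : ¬ ∀ x : ell1, ‖x‖ ≤ C * ‖incl12 x‖ := by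
  intro h
  obtain ⟨m, hm⟩ := exists_nat_gt (max C 0)
  obtain ⟨hCm, hm0⟩ := max_lt_iff.mp hm
  set x : ell1 := ∑ i ∈ Finset.range (m ^ 2), lp.single 1 i 1
  have hx1 : ‖x‖ = (m : ℝ) ^ 2 := by
    have := norm_sum_single_one_rpow (p := 1) (by norm_num) (m ^ 2)
    rwa [ENNReal.toReal_one, Real.rpow_one, Nat.cast_pow] at this
  have hx : incl12 x = ∑ i ∈ Finset.range (m ^ 2), lp.single 2 i 1 :=
    (map_sum incl12CLM _ _).trans (Finset.sum_congr rfl fun i _ => incl12_single i 1)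
  have hx2 : ‖incl12 x‖ = m := by
    have := norm_sum_single_one_rpow (p := 2) (by norm_num) (m ^ 2)
    rw [← hx] at this
    refine (pow_left_inj₀ (norm_nonneg _) hm0.le two_ne_zero).mp ?_
    simpa using this
  have := h x
  rw [hx1, hx2] at this
  nlinarith

/-- If `T : ℓ² → Y` is an injective bounded linear operator into a Banach space `Y` and
`A : ℓ¹ → Y` is defined by `A x = T x` (via the embedding `ℓ¹ ⊆ ℓ²`), then the range of `A`
is not closed in `Y`. -/
theorem range_of_ell1_restriction_not_closed
    {Y : Type*} [NormedAddCommGroup Y] [NormedSpace ℝ Y] [CompleteSpace Y]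
    (T : ell2 →L[ℝ] Y) (hT : Function.Injective T) :
    ¬ IsClosed (Set.range fun x : ell1 => T (incl12 x)) := by
  intro hclosed
  obtain ⟨K, hK⟩ := (T.comp incl12CLM).antilipschitz_of_injective_of_isClosed_range
    (hT.comp incl12_injective) hclosed
  refine not_forall_norm_le_mul_norm_incl12 (K * ‖T‖) fun x => ?_
  calc ‖x‖ ≤ K * ‖T (incl12 x)‖ := ZeroHomClass.bound_of_antilipschitz (T.comp incl12CLM) hK x
    _ ≤ K * (‖T‖ * ‖incl12 x‖) := by gcongr; exact T.le_opNorm _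
    _ = K * ‖T‖ * ‖incl12 x‖ := by ring
end
end

section
/- Let Y be a Banach space, T : ℓ² → Y a bounded linear operator, and define A : ℓ¹ → Y by A x = T x (using the embedding of ℓ¹ into ℓ²). Fix 1 < p < ∞, α > 0 and y^δ ∈ Y. Then every minimizer x_α^δ ∈ ℓ¹ of the functional F(x) = (1/p)‖A x − y^δ‖_Y^p + α‖x‖_{ℓ¹} over ℓ¹ is sparse, i.e., x_α^δ has only finitely many nonzero components. -/
open scoped ENNReal

noncomputable section

/-- The increment bound `(r + s)^p - r^p ≤ s ((r + 1)^p - r^p)` for `0 ≤ s ≤ 1`, from convexity. -/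
lemma rpow_add_le_of_convex {p r s : ℝ} (hp : 1 ≤ p) (hr : 0 ≤ r) (hs0 : 0 ≤ s) (hs1 : s ≤ 1) :
    (r + s) ^ p ≤ r ^ p + s * ((r + 1) ^ p - r ^ p) := by
  have h := (convexOn_rpow hp).2 (show r ∈ Set.Ici (0 : ℝ) from hr)
    (show r + 1 ∈ Set.Ici (0 : ℝ) from by simp only [Set.mem_Ici]; linarith)
    (sub_nonneg.2 hs1) hs0 (by ring)
  simp only [smul_eq_mul] at h
  have e : (1 - s) * r + s * (r + 1) = r + s := by ring
  rw [e] at h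
  linarith

lemma incl12_apply (x : ell1) (k : ℕ) : incl12 x k = x k := rfl

lemma incl12_sub_smul (x z : ell1) (t : ℝ) :
    incl12 (x - t • z) = incl12 x - t • incl12 z := by
  ext k
  simp only [incl12_apply, lp.coeFn_sub, lp.coeFn_smul, Pi.sub_apply, Pi.smul_apply]

/-- The sign pattern of `x` on the finite set `S`, as an element of `ℓ¹`. -/
def signOn (x : ℕ → ℝ) (S : Finset ℕ) : ell1 :=
  ⟨fun k => if k ∈ S then SignType.sign (x k) else 0,
    (memℓp_zero (S.finite_toSet.subset fun k hk => by
      by_contra h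
      exact hk (if_neg h))).of_exponent_ge zero_le⟩

lemma signOn_apply (x : ℕ → ℝ) (S : Finset ℕ) (k : ℕ) :
    signOn x S k = if k ∈ S then (SignType.sign (x k) : ℝ) else 0 := rfl

lemma norm_incl12_signOn_sq_le (x : ℕ → ℝ) (S : Finset ℕ) :
    ‖incl12 (signOn x S)‖ ^ 2 ≤ S.card := by
  have h := lp.norm_rpow_eq_tsum (p := 2) (by norm_num) (incl12 (signOn x S))
  simp only [ENNReal.toReal_ofNat, Real.rpow_ofNat] at h
  rw [h, tsum_eq_sum (s := S)]
  · rw [Finset.card_eq_sum_ones, Nat.cast_sum]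
    refine Finset.sum_le_sum fun k hk => ?_
    rw [incl12_apply, signOn_apply, if_pos hk]
    rcases lt_trichotomy (x k) 0 with h | h | h <;> simp [h]
  · intro k hk
    simp [incl12_apply, signOn_apply, hk]

/-- Shrinking the entries of `x` in `S` by a small `t` lowers the `ℓ¹` norm by `t * S.card`. -/
lemma norm_sub_smul_signOn (x : ell1) (S : Finset ℕ) {t : ℝ}
    (ht : ∀ k ∈ S, t ≤ |x k|) (hS : ∀ k ∈ S, x k ≠ 0) :
    ‖x - t • signOn x S‖ + t * S.card = ‖x‖ := by
  have norm_hasSum (z : ell1) : HasSum (fun k => |z k|) ‖z‖ := by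
    simpa using lp.hasSum_norm (p := 1) (by norm_num) z
  have hs : HasSum (fun k => if k ∈ S then t else 0) (t * S.card) := by
    have := hasSum_sum_of_ne_finset_zero (L := .unconditional ℕ) (f := fun k => if k ∈ S then t else 0) (s := S)
      (fun k hk => if_neg hk)
    simpa [mul_comm] using this
  refine ((norm_hasSum _).add hs).unique ?_
  convert norm_hasSum x using 2 with k
  simp only [lp.coeFn_sub, lp.coeFn_smul, Pi.sub_apply, Pi.smul_apply, smul_eq_mul, signOn_apply]
  by_cases hk : k ∈ S
  · have h1 := ht k hk
    rcases (hS k hk).lt_or_gt with h | h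
    · rw [abs_of_neg h] at h1 ⊢
      simp only [hk, if_true, sign_neg h, SignType.coe_neg_one]
      rw [abs_of_nonpos (by linarith)]
      ring
    · rw [abs_of_pos h] at h1 ⊢
      simp only [hk, if_true, sign_pos h, SignType.coe_one]
      rw [abs_of_nonneg (by linarith)]
      ring
  · simp [hk]

/-- Sparsity of `ℓ¹`-regularized solutions: every minimizer of the Tikhonov functional
`F(x) = (1/p)‖A x − y^δ‖^p + α‖x‖_{ℓ¹}` with `A = T ∘ E₂` has only finitely many nonzero
components. -/
theorem l1_Tikhonov_minimizer_sparse
    {Y : Type*} [NormedAddCommGroup Y] [NormedSpace ℝ Y] [CompleteSpace Y]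
    (T : ell2 →L[ℝ] Y) (p : ℝ) (hp1 : 1 < p) (α : ℝ) (hα : 0 < α) (yδ : Y)
    (xmin : ell1)
    (hmin : ∀ x : ell1,
      (1 / p) * ‖T (incl12 xmin) - yδ‖ ^ p + α * ‖xmin‖ ≤
        (1 / p) * ‖T (incl12 x) - yδ‖ ^ p + α * ‖x‖) :
    {k : ℕ | (xmin : ℕ → ℝ) k ≠ 0}.Finite := by
  by_contra hinf
  set r := ‖T (incl12 xmin) - yδ‖
  have hr0 : 0 ≤ r := norm_nonneg _
  have hp0 : 0 < p := by linarith
  set C := (1 / p) * ((r + 1) ^ p - r ^ p) with hC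
  have hC0 : 0 ≤ C := mul_nonneg (by positivity)
    (sub_nonneg.2 (Real.rpow_le_rpow hr0 (by linarith) hp0.le))
  obtain ⟨m, hm⟩ := exists_nat_gt (C * ‖T‖ / α)
  have hm0 : (0 : ℝ) < m := lt_of_le_of_lt (by positivity) hm
  obtain ⟨S, hS, hcard⟩ := Set.Infinite.exists_subset_card_eq hinf (m ^ 2)
  have hSx : ∀ k ∈ S, (xmin : ℕ → ℝ) k ≠ 0 := fun k hk => hS hk
  have hd : ‖incl12 (signOn xmin S)‖ ≤ m := by
    have := norm_incl12_signOn_sq_le xmin S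
    rw [hcard, Nat.cast_pow] at this
    exact le_of_sq_le_sq this hm0.le
  obtain ⟨t, ht0, htS, ht1⟩ : ∃ t : ℝ, 0 < t ∧ (∀ k ∈ S, t ≤ |xmin k|) ∧ t * (‖T‖ * m) ≤ 1 := by
    have hne : S.Nonempty := Finset.card_pos.1 (by
      rw [hcard]
      exact pow_pos (by exact_mod_cast hm0) 2)
    refine ⟨min (S.inf' hne fun k => |xmin k|) (1 / (‖T‖ * m + 1)), lt_min ?_ (by positivity),
      fun k hk => (min_le_left _ _).trans (Finset.inf'_le _ hk), ?_⟩
    · exact (Finset.lt_inf'_iff _).2 fun k hk => abs_pos.2 (hSx k hk)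
    · calc _ ≤ 1 / (‖T‖ * m + 1) * (‖T‖ * m) := by gcongr; exact min_le_right _ _
        _ ≤ 1 := by
          rw [one_div_mul_eq_div, div_le_one (by positivity)]
          linarith
  have hF := hmin (xmin - t • signOn xmin S)
  have hnorm := norm_sub_smul_signOn xmin S htS hSx
  have hres : ‖T (incl12 (xmin - t • signOn xmin S)) - yδ‖ ≤ r + t * (‖T‖ * m) := by
    rw [incl12_sub_smul, map_sub, map_smul, sub_right_comm]
    refine (norm_sub_le _ _).trans (add_le_add le_rfl ?_)
    rw [norm_smul, Real.norm_of_nonneg ht0.le]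
    gcongr
    exact (T.le_opNorm _).trans (by gcongr)
  have hpow := (Real.rpow_le_rpow (norm_nonneg _) hres hp0.le).trans
    (rpow_add_le_of_convex hp1.le hr0 (by positivity) ht1)
  have hfit := mul_le_mul_of_nonneg_left hpow (one_div_pos.2 hp0).le
  have hdecr : α * (t * m ^ 2) ≤ t * (‖T‖ * m) * C := by
    rw [hcard, Nat.cast_pow] at hnorm
    rw [← hnorm] at hF
    rw [hC]
    linarith
  rw [div_lt_iff₀ hα] at hm
  have := mul_lt_mul_of_pos_left hm (mul_pos ht0 hm0)
  linarith
end
end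

section
/- Let Y be a Banach space, A : ℓ¹ → Y a bounded linear operator, n ∈ ℕ, and let f^(1), …, f^(n) ∈ Y* be continuous linear functionals satisfying the link condition x_k = f^(k)(A x) for all x ∈ ℓ¹ and k = 1, …, n. Then for all x, x† ∈ ℓ¹: Σ_{k=1}^n |x_k − x†_k| ≤ ‖A x − A x†‖_Y · sup { ‖Σ_{k=1}^n a_k f^(k)‖_{Y*} : a_k ∈ {−1, 0, 1} for k = 1, …, n }. -/
open scoped ENNReal

noncomputable section

theorem norm_sum_sign_smul_le {Y : Type*} [NormedAddCommGroup Y] [NormedSpace ℝ Y]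
    {n : ℕ} (f : Fin n → (Y →L[ℝ] ℝ)) {a : Fin n → ℝ}
    (ha : ∀ k, a k ∈ ({-1, 0, 1} : Set ℝ)) :
    ‖∑ k : Fin n, a k • f k‖ ≤ ∑ k : Fin n, ‖f k‖ := by
  refine norm_sum_le_of_le _ fun k _ => ?_
  rcases ha k with h | h | (h : a k = 1) <;> simp [h, norm_smul]

/-- If the continuous linear functionals `f⁽ᵏ⁾ ∈ Y*`, `k = 0,…,n−1`, satisfy the link
condition `x_k = f⁽ᵏ⁾(A x)` for all `x ∈ ℓ¹`, then for all `x, x† ∈ ℓ¹` the sum of the first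
`n` coordinate errors is bounded by `‖A x − A x†‖` times the supremum of `‖Σ a_k f⁽ᵏ⁾‖` over
all sign patterns `a_k ∈ {−1, 0, 1}`. -/
theorem sum_coord_err_le_sup_dual_combinations
    {Y : Type*} [NormedAddCommGroup Y] [NormedSpace ℝ Y]
    (A : ell1 →L[ℝ] Y) (n : ℕ) (f : Fin n → (Y →L[ℝ] ℝ))
    (hf : ∀ (x : ell1) (k : Fin n), (x : ℕ → ℝ) k = f k (A x))
    (x xdag : ell1) :
    ∑ k : Fin n, |(x : ℕ → ℝ) k - (xdag : ℕ → ℝ) k| ≤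
      ‖A x - A xdag‖ *
        sSup {c : ℝ | ∃ a : Fin n → ℝ, (∀ k, a k ∈ ({-1, 0, 1} : Set ℝ)) ∧
          c = ‖∑ k : Fin n, a k • f k‖} := by
  set y := A x - A xdag with hy
  let a : Fin n → ℝ := fun k => SignType.sign (f k y)
  have ha : ∀ k, a k ∈ ({-1, 0, 1} : Set ℝ) := fun k => by
    rcases h : SignType.sign (f k y) <;> simp [a, h]
  calc ∑ k : Fin n, |(x : ℕ → ℝ) k - (xdag : ℕ → ℝ) k|
      = (∑ k : Fin n, a k • f k) y := by
        rw [sum_apply]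
        refine Finset.sum_congr rfl fun k _ => ?_
        rw [hf x k, hf xdag k, ← map_sub, ← hy]
        exact (sign_mul_self (f k y)).symm
    _ ≤ ‖∑ k : Fin n, a k • f k‖ * ‖y‖ :=
        (le_abs_self _).trans ((∑ k : Fin n, a k • f k).le_opNorm y)
    _ ≤ _ := by
        rw [mul_comm]
        refine mul_le_mul_of_nonneg_left (le_csSup ⟨∑ k, ‖f k‖, ?_⟩ ⟨a, ha, rfl⟩) (norm_nonneg y)
        rintro _ ⟨b, hb, rfl⟩
        exact norm_sum_sign_smul_le f hb
end
end

section
/- Let Y be a Banach space, A : ℓ¹ → Y a bounded linear operator, and let f^(k) ∈ Y*, k ∈ ℕ, satisfy the link condition x_k = f^(k)(A x) for all x ∈ ℓ¹ and all k ∈ ℕ. Then for every x† ∈ ℓ¹ the variational inequality ‖x − x†‖_{ℓ¹} ≤ ‖x‖_{ℓ¹} − ‖x†‖_{ℓ¹} + φ₁(‖A x − A x†‖_Y) holds for all x ∈ ℓ¹, where φ₁(t) = 2 inf_{n∈ℕ} ( Σ_{k=n+1}^∞ |x†_k| + t Σ_{k=1}^n ‖f^(k)‖_{Y*} ). -/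
open scoped ENNReal

noncomputable section

theorem ell1.hasSum_abs (v : ell1) : HasSum (fun k => |(v : ℕ → ℝ) k|) ‖v‖ := by
  simpa using lp.hasSum_norm (p := 1) (by norm_num) v

theorem ell1.norm_eq_sum_range_add_tsum_abs (v : ell1) (n : ℕ) :
    ‖v‖ = ∑ k ∈ Finset.range n, |(v : ℕ → ℝ) k| + ∑' k, |(v : ℕ → ℝ) (k + n)| := by
  rw [(ell1.hasSum_abs v).summable.sum_add_tsum_nat_add n, (ell1.hasSum_abs v).tsum_eq]

/-- Cutting `ℓ¹` vectors at index `n` bounds the defect in the triangle inequality by twice the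
tail of `u` and twice the head of `v - u`. -/
theorem ell1.norm_sub_le_add_tail_add_head (u v : ell1) (n : ℕ) :
    ‖v - u‖ ≤ ‖v‖ - ‖u‖ + 2 * ((∑' k, |(u : ℕ → ℝ) (k + n)|) +
      ∑ k ∈ Finset.range n, |(v - u : ell1) k|) := by
  have tail_summable (w : ell1) : Summable fun k => |(w : ℕ → ℝ) (k + n)| :=
    (summable_nat_add_iff n).2 (ell1.hasSum_abs w).summable
  have htail : ∑' k, |(v - u : ell1) (k + n)| ≤
      ∑' k, |(v : ℕ → ℝ) (k + n)| + ∑' k, |(u : ℕ → ℝ) (k + n)| := by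
    rw [← (tail_summable v).tsum_add (tail_summable u)]
    exact (tail_summable (v - u)).tsum_le_tsum (fun k => abs_sub _ _)
      ((tail_summable v).add (tail_summable u))
  have hhead : ∑ k ∈ Finset.range n, |(u : ℕ → ℝ) k| ≤
      ∑ k ∈ Finset.range n, |(v : ℕ → ℝ) k| + ∑ k ∈ Finset.range n, |(v - u : ell1) k| := by
    rw [← Finset.sum_add_distrib]
    refine Finset.sum_le_sum fun k _ => ?_
    simpa using abs_sub ((v : ℕ → ℝ) k) ((v - u : ell1) k)
  linarith [ell1.norm_eq_sum_range_add_tsum_abs v n, ell1.norm_eq_sum_range_add_tsum_abs u n,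
    ell1.norm_eq_sum_range_add_tsum_abs (v - u) n]

/-- Variational inequality with the index function
`φ₁(t) = 2 inf_n (Σ_{k>n} |x†_k| + t Σ_{k≤n} ‖f⁽ᵏ⁾‖)` under the link condition
`x_k = f⁽ᵏ⁾(A x)` for all `x ∈ ℓ¹` and all `k ∈ ℕ`. -/
theorem variational_inequality_phi1
    {Y : Type*} [NormedAddCommGroup Y] [NormedSpace ℝ Y]
    (A : ell1 →L[ℝ] Y) (f : ℕ → (Y →L[ℝ] ℝ))
    (hf : ∀ (x : ell1) (k : ℕ), (x : ℕ → ℝ) k = f k (A x))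
    (xdag x : ell1) :
    ‖x - xdag‖ ≤ ‖x‖ - ‖xdag‖ +
      2 * ⨅ n : ℕ, ((∑' k : ℕ, |(xdag : ℕ → ℝ) (k + n)|) +
        ‖A x - A xdag‖ * ∑ k ∈ Finset.range n, ‖f k‖) := by
  suffices h : (‖x - xdag‖ - ‖x‖ + ‖xdag‖) / 2 ≤
      ⨅ n : ℕ, ((∑' k : ℕ, |(xdag : ℕ → ℝ) (k + n)|) +
        ‖A x - A xdag‖ * ∑ k ∈ Finset.range n, ‖f k‖) by linarith
  refine le_ciInf fun n => ?_
  have hhead : ∑ k ∈ Finset.range n, |(x - xdag : ell1) k| ≤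
      ‖A x - A xdag‖ * ∑ k ∈ Finset.range n, ‖f k‖ := by
    rw [Finset.mul_sum]
    refine Finset.sum_le_sum fun k _ => ?_
    rw [hf, map_sub, mul_comm]
    exact (f k).le_opNorm _
  linarith [ell1.norm_sub_le_add_tail_add_head xdag x n]
end
end

section
/- Let Y be a Banach space, A : ℓ¹ → Y a bounded linear operator, and let f^(k) ∈ Y*, k ∈ ℕ, satisfy the link condition x_k = f^(k)(A x) for all x ∈ ℓ¹ and all k ∈ ℕ. Then for every x† ∈ ℓ¹ the variational inequality ‖x − x†‖_{ℓ¹} ≤ ‖x‖_{ℓ¹} − ‖x†‖_{ℓ¹} + φ₂(‖A x − A x†‖_Y) holds for all x ∈ ℓ¹, where φ₂(t) = 2 inf_{n∈ℕ} ( Σ_{k=n+1}^∞ |x†_k| + t · sup { ‖Σ_{k=1}^n a_k f^(k)‖_{Y*} : a_k ∈ {−1, 0, 1} for k = 1, …, n } ). -/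
open scoped ENNReal

noncomputable section

theorem ell1.summable_abs (x : ell1) : Summable fun k => |(x : ℕ → ℝ) k| := by
  simpa using (lp.memℓp x).summable (by simp)

theorem ell1.norm_eq_tsum_abs (x : ell1) : ‖x‖ = ∑' k, |(x : ℕ → ℝ) k| := by
  simpa using lp.norm_eq_tsum_rpow (by simp) x

theorem ell1.norm_sub_add_norm_sub_norm_le (x y : ell1) (n : ℕ) :
    ‖x - y‖ + ‖y‖ - ‖x‖ ≤
      2 * (∑ k ∈ Finset.range n, |((x - y : ell1) : ℕ → ℝ) k| +
        ∑' k, |(y : ℕ → ℝ) (k + n)|) := by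
  have hd := ell1.summable_abs (x - y)
  have hx := ell1.summable_abs x
  have hy := ell1.summable_abs y
  have hsum := (hd.add hy).sub hx
  have hyn : Summable fun k => |(y : ℕ → ℝ) (k + n)| := (summable_nat_add_iff n).2 hy
  rw [ell1.norm_eq_tsum_abs, ell1.norm_eq_tsum_abs x, ell1.norm_eq_tsum_abs y,
    ← hd.tsum_add hy, ← (hd.add hy).tsum_sub hx, ← hsum.sum_add_tsum_nat_add n, mul_add,
    Finset.mul_sum, ← tsum_mul_left]
  refine add_le_add (Finset.sum_le_sum fun k _ => ?_)
    (((summable_nat_add_iff n).2 hsum).tsum_le_tsum (fun k => ?_) (hyn.mul_left 2))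
  · have h := abs_sub_abs_le_abs_sub ((y : ℕ → ℝ) k) ((x : ℕ → ℝ) k)
    rw [abs_sub_comm] at h
    simp only [lp.coeFn_sub, Pi.sub_apply]
    linarith
  · have h := abs_sub ((x : ℕ → ℝ) (k + n)) ((y : ℕ → ℝ) (k + n))
    simp only [lp.coeFn_sub, Pi.sub_apply]
    linarith

theorem bddAbove_norm_sum_smul {E : Type*} [SeminormedAddCommGroup E] [NormedSpace ℝ E]
    (f : ℕ → E) (n : ℕ) :
    BddAbove {c : ℝ | ∃ a : ℕ → ℝ, (∀ k < n, a k ∈ ({-1, 0, 1} : Set ℝ)) ∧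
      c = ‖∑ k ∈ Finset.range n, a k • f k‖} := by
  refine ⟨∑ k ∈ Finset.range n, ‖f k‖, ?_⟩
  rintro c ⟨a, ha, rfl⟩
  refine norm_sum_le_of_le _ fun k hk => ?_
  have h := ha k (Finset.mem_range.1 hk)
  simp only [Set.mem_insert_iff, Set.mem_singleton_iff] at h
  rcases h with h | h | h <;> simp [h]

theorem sum_abs_apply_le {Y : Type*} [SeminormedAddCommGroup Y] [NormedSpace ℝ Y]
    (f : ℕ → (Y →L[ℝ] ℝ)) (n : ℕ) (y : Y) :
    ∑ k ∈ Finset.range n, |f k y| ≤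
      ‖y‖ * sSup {c : ℝ | ∃ a : ℕ → ℝ, (∀ k < n, a k ∈ ({-1, 0, 1} : Set ℝ)) ∧
        c = ‖∑ k ∈ Finset.range n, a k • f k‖} := by
  let a : ℕ → ℝ := fun k => SignType.sign (f k y)
  have ha : ∀ k < n, a k ∈ ({-1, 0, 1} : Set ℝ) := fun k _ => by
    rcases lt_trichotomy (f k y) 0 with h | h | h <;> simp [a, h]
  calc ∑ k ∈ Finset.range n, |f k y| = (∑ k ∈ Finset.range n, a k • f k) y := by
        simp [a, sum_apply, sign_mul_self]
    _ ≤ ‖∑ k ∈ Finset.range n, a k • f k‖ * ‖y‖ :=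
        (Real.le_norm_self _).trans (ContinuousLinearMap.le_opNorm _ y)
    _ ≤ _ := by
        rw [mul_comm]
        exact mul_le_mul_of_nonneg_left
          (le_csSup (bddAbove_norm_sum_smul f n) ⟨a, ha, rfl⟩) (norm_nonneg y)

/-- Improved variational inequality with the index function
`φ₂(t) = 2 inf_n (Σ_{k>n} |x†_k| + t · sup_{a_k ∈ {−1,0,1}} ‖Σ_{k≤n} a_k f⁽ᵏ⁾‖)`
under the link condition `x_k = f⁽ᵏ⁾(A x)` for all `x ∈ ℓ¹` and all `k ∈ ℕ`. -/
theorem variational_inequality_phi2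
    {Y : Type*} [NormedAddCommGroup Y] [NormedSpace ℝ Y]
    (A : ell1 →L[ℝ] Y) (f : ℕ → (Y →L[ℝ] ℝ))
    (hf : ∀ (x : ell1) (k : ℕ), (x : ℕ → ℝ) k = f k (A x))
    (xdag x : ell1) :
    ‖x - xdag‖ ≤ ‖x‖ - ‖xdag‖ +
      2 * ⨅ n : ℕ, ((∑' k : ℕ, |(xdag : ℕ → ℝ) (k + n)|) +
        ‖A x - A xdag‖ *
          sSup {c : ℝ | ∃ a : ℕ → ℝ, (∀ k < n, a k ∈ ({-1, 0, 1} : Set ℝ)) ∧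
            c = ‖∑ k ∈ Finset.range n, a k • f k‖}) := by
  suffices h : (‖x - xdag‖ + ‖xdag‖ - ‖x‖) / 2 ≤ ⨅ n : ℕ,
      ((∑' k : ℕ, |(xdag : ℕ → ℝ) (k + n)|) + ‖A x - A xdag‖ *
        sSup {c : ℝ | ∃ a : ℕ → ℝ, (∀ k < n, a k ∈ ({-1, 0, 1} : Set ℝ)) ∧
          c = ‖∑ k ∈ Finset.range n, a k • f k‖}) by linarith
  refine le_ciInf fun n => ?_
  have h := ell1.norm_sub_add_norm_sub_norm_le x xdag n
  have hA := sum_abs_apply_le f n (A (x - xdag))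
  simp only [← hf] at hA
  rw [map_sub] at hA
  linarith
end
end

section
/- Let γ, ν > 0 and K₁, K₂ ≥ 0. Then there exist a constant C > 0 and a threshold t̄ ∈ (0, 1) such that for all t ∈ (0, t̄]: inf_{n∈ℕ, n≥1} ( K₁ exp(−n^γ) + t K₂ n^{ν} ) ≤ C · t · (log(1/t))^{ν/γ}. -/
noncomputable section

/-- Logarithmic rate estimate for exponentially decaying tails: for `γ, ν > 0` and
`K₁, K₂ ≥ 0` there are `C > 0` and a threshold `t̄ ∈ (0, 1)` with
`inf_{n ≥ 1} (K₁ exp(−n^γ) + t K₂ n^{ν}) ≤ C t (log(1/t))^{ν/γ}` for all `t ∈ (0, t̄]`. -/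
theorem exponential_decay_rate_infimum_bound
    (γ ν K₁ K₂ : ℝ) (hγ : 0 < γ) (hν : 0 < ν) (hK₁ : 0 ≤ K₁) (hK₂ : 0 ≤ K₂) :
    ∃ C : ℝ, 0 < C ∧ ∃ tbar : ℝ, tbar ∈ Set.Ioo (0 : ℝ) 1 ∧
      ∀ t ∈ Set.Ioc (0 : ℝ) tbar,
        (⨅ n : {m : ℕ // 1 ≤ m},
            (K₁ * Real.exp (-(n.1 : ℝ) ^ γ) + t * (K₂ * (n.1 : ℝ) ^ ν))) ≤
          C * t * (Real.log (1 / t)) ^ (ν / γ) := by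
  refine ⟨K₁ + K₂ * 2 ^ ν + 1, by positivity, Real.exp (-1),
    ⟨Real.exp_pos _, Real.exp_lt_one_iff.mpr (by norm_num)⟩, ?_⟩
  rintro t ⟨ht0, ht⟩
  set L := Real.log (1 / t) with hL
  have hLt : L = -Real.log t := by rw [hL, one_div, Real.log_inv]
  have hL1 : 1 ≤ L := by
    have h := Real.log_le_log ht0 ht
    rw [Real.log_exp] at h
    linarith
  have hL0 : 0 ≤ L := zero_le_one.trans hL1
  set x := L ^ (1 / γ) with hx
  have hx1 : 1 ≤ x := Real.one_le_rpow hL1 (by positivity)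
  have hxγ : x ^ γ = L := by
    rw [hx, ← Real.rpow_mul hL0, one_div_mul_cancel hγ.ne', Real.rpow_one]
  have hxν : x ^ ν = L ^ (ν / γ) := by
    rw [hx, ← Real.rpow_mul hL0, one_div_mul_eq_div]
  have hle : x ≤ ⌈x⌉₊ := Nat.le_ceil x
  have hlt : (⌈x⌉₊ : ℝ) < x + 1 := Nat.ceil_lt_add_one (by linarith)
  have hexp : Real.exp (-(⌈x⌉₊ : ℝ) ^ γ) ≤ t := by
    have h : L ≤ (⌈x⌉₊ : ℝ) ^ γ := hxγ ▸ Real.rpow_le_rpow (by linarith) hle hγ.le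
    calc Real.exp (-(⌈x⌉₊ : ℝ) ^ γ) ≤ Real.exp (Real.log t) :=
          Real.exp_le_exp.mpr (by linarith)
      _ = t := Real.exp_log ht0
  have hpow : (⌈x⌉₊ : ℝ) ^ ν ≤ 2 ^ ν * L ^ (ν / γ) := by
    rw [← hxν, ← Real.mul_rpow (by norm_num) (by linarith)]
    exact Real.rpow_le_rpow (by positivity) (by linarith) hν.le
  have hM : 1 ≤ L ^ (ν / γ) := Real.one_le_rpow hL1 (by positivity)
  have hbdd : BddBelow (Set.range fun n : {m : ℕ // 1 ≤ m} =>
      K₁ * Real.exp (-(n.1 : ℝ) ^ γ) + t * (K₂ * (n.1 : ℝ) ^ ν)) :=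
    ⟨0, by rintro _ ⟨n, rfl⟩; positivity⟩
  refine (ciInf_le hbdd ⟨⌈x⌉₊, Nat.one_le_ceil_iff.mpr (by linarith)⟩).trans ?_
  calc K₁ * Real.exp (-(⌈x⌉₊ : ℝ) ^ γ) + t * (K₂ * (⌈x⌉₊ : ℝ) ^ ν)
      ≤ K₁ * (t * L ^ (ν / γ)) + t * (K₂ * (2 ^ ν * L ^ (ν / γ))) := by
        gcongr
        exact hexp.trans (le_mul_of_one_le_right ht0.le hM)
    _ ≤ (K₁ + K₂ * 2 ^ ν + 1) * t * L ^ (ν / γ) := by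
        have h : 0 ≤ t * L ^ (ν / γ) := by positivity
        linarith
end
end

section
/- Define f^(1) = e^(1) and f^(k) = k e^(k) − (k−1) e^(k−1) ∈ ℓ² for k ≥ 2. Then for every n ∈ ℕ: sup { ‖Σ_{k=1}^n a_k f^(k)‖_{ℓ²} : a_k ∈ {−1, 0, 1} for k = 1, …, n } = √( (4/3)n³ − n² + (2/3)n ) ≤ (2/√3) n^{3/2}, and the supremum is attained at a_k = (−1)^k. -/
open scoped ENNReal

noncomputable section

/-- The dual elements for the Cesàro operator (`0`-based):
`f⁽ᵏ⁾ = (k+1) e⁽ᵏ⁾ − k e⁽ᵏ⁻¹⁾` (for `k = 0` this is `e⁽⁰⁾`). -/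
def cesaroDualLp (k : ℕ) : ell2 :=
  ((k : ℝ) + 1) • (lp.single 2 k (1 : ℝ) : ell2) -
    (k : ℝ) • (lp.single 2 (k - 1) (1 : ℝ) : ell2)

/-- Summation by parts for combinations of the dual elements. -/
theorem sum_smul_cesaroDualLp (a : ℕ → ℝ) (n : ℕ) :
    ∑ k ∈ Finset.range (n + 1), a k • cesaroDualLp k =
      ∑ i ∈ Finset.range n,
          (((i : ℝ) + 1) * (a i - a (i + 1))) • (lp.single 2 i (1 : ℝ) : ell2) +
        (((n : ℝ) + 1) * a n) • (lp.single 2 n (1 : ℝ) : ell2) := by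
  induction n with
  | zero => simp [cesaroDualLp]
  | succ n ih =>
    rw [Finset.sum_range_succ, ih, Finset.sum_range_succ, cesaroDualLp, Nat.add_sub_cancel]
    push_cast
    module

theorem norm_sq_sum_smul_single (c : ℕ → ℝ) (s : Finset ℕ) :
    ‖∑ i ∈ s, c i • (lp.single 2 i (1 : ℝ) : ell2)‖ ^ 2 = ∑ i ∈ s, c i ^ 2 := by
  have h := lp.norm_sum_single (E := fun _ : ℕ => ℝ) (p := 2) (by norm_num) c s
  simp only [ENNReal.toReal_ofNat, Real.rpow_ofNat, Real.norm_eq_abs, sq_abs] at h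
  rw [← h]
  congr 3 with i
  rw [← lp.single_smul, smul_eq_mul, mul_one]

theorem norm_sq_sum_smul_cesaroDualLp (a : ℕ → ℝ) (n : ℕ) :
    ‖∑ k ∈ Finset.range (n + 1), a k • cesaroDualLp k‖ ^ 2 =
      ∑ i ∈ Finset.range n, (((i : ℝ) + 1) * (a i - a (i + 1))) ^ 2 +
        (((n : ℝ) + 1) * a n) ^ 2 := by
  have h := norm_sq_sum_smul_single
    (fun i => if i < n then ((i : ℝ) + 1) * (a i - a (i + 1)) else ((n : ℝ) + 1) * a n)
    (Finset.range (n + 1))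
  rw [Finset.sum_range_succ, Finset.sum_range_succ] at h
  simp only [lt_irrefl, if_false] at h
  rw [sum_smul_cesaroDualLp]
  convert h using 4
  · refine Finset.sum_congr rfl fun i hi => ?_
    rw [if_pos (Finset.mem_range.1 hi)]
  · rename_i i hi
    rw [if_pos (Finset.mem_range.1 hi)]

theorem sum_four_mul_sq_add_sq (n : ℕ) :
    ∑ i ∈ Finset.range n, 4 * ((i : ℝ) + 1) ^ 2 + ((n : ℝ) + 1) ^ 2 =
      (4 / 3) * ((n + 1 : ℕ) : ℝ) ^ 3 - ((n + 1 : ℕ) : ℝ) ^ 2 + (2 / 3) * ((n + 1 : ℕ) : ℝ) := by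
  induction n with
  | zero => norm_num
  | succ n ih =>
    rw [Finset.sum_range_succ]
    push_cast at ih ⊢
    linarith

theorem norm_sum_smul_cesaroDualLp_le (a : ℕ → ℝ) (n : ℕ) (ha : ∀ k < n, |a k| ≤ 1) :
    ‖∑ k ∈ Finset.range n, a k • cesaroDualLp k‖ ≤
      Real.sqrt ((4 / 3) * (n : ℝ) ^ 3 - (n : ℝ) ^ 2 + (2 / 3) * (n : ℝ)) := by
  cases n with
  | zero => simp
  | succ n =>
    apply Real.le_sqrt_of_sq_le
    rw [norm_sq_sum_smul_cesaroDualLp, ← sum_four_mul_sq_add_sq]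
    refine add_le_add (Finset.sum_le_sum fun i hi => ?_) ?_
    · have hi := Finset.mem_range.1 hi
      have h := (abs_sub (a i) (a (i + 1))).trans
        (add_le_add (ha i (by lia)) (ha (i + 1) (by lia)))
      rw [mul_pow, mul_comm]
      gcongr
      rw [← sq_abs]
      nlinarith [abs_nonneg (a i - a (i + 1))]
    · rw [mul_pow]
      exact mul_le_of_le_one_right (sq_nonneg _) ((sq_le_one_iff_abs_le_one _).2 (ha n (by lia)))

theorem norm_sum_alternating_smul_cesaroDualLp (n : ℕ) :
    ‖∑ k ∈ Finset.range n, ((-1 : ℝ)) ^ (k + 1) • cesaroDualLp k‖ =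
      Real.sqrt ((4 / 3) * (n : ℝ) ^ 3 - (n : ℝ) ^ 2 + (2 / 3) * (n : ℝ)) := by
  cases n with
  | zero => simp
  | succ n =>
    rw [← Real.sqrt_sq (norm_nonneg _),
      norm_sq_sum_smul_cesaroDualLp (fun k => (-1 : ℝ) ^ (k + 1)), ← sum_four_mul_sq_add_sq]
    have hs (k : ℕ) : ((-1 : ℝ) ^ k) ^ 2 = 1 := by rw [← pow_mul, mul_comm, pow_mul]; simp
    congr 2
    · refine Finset.sum_congr rfl fun i _ => ?_
      linear_combination 4 * ((i : ℝ) + 1) ^ 2 * hs i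
    · rw [mul_pow, hs, mul_one]

theorem sqrt_cubic_le_rpow (n : ℕ) :
    Real.sqrt ((4 / 3) * (n : ℝ) ^ 3 - (n : ℝ) ^ 2 + (2 / 3) * (n : ℝ)) ≤
      (2 / Real.sqrt 3) * (n : ℝ) ^ ((3 : ℝ) / 2) := by
  have hn : (n : ℝ) ≤ (n : ℝ) ^ 2 := by exact_mod_cast Nat.le_self_pow two_ne_zero n
  have hpow : ((n : ℝ) ^ ((3 : ℝ) / 2)) ^ 2 = (n : ℝ) ^ 3 := by
    rw [← Real.rpow_mul_natCast n.cast_nonneg, ← Real.rpow_natCast]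
    norm_num
  rw [Real.sqrt_le_iff]
  refine ⟨by positivity, ?_⟩
  rw [mul_pow, hpow, div_pow, Real.sq_sqrt (by norm_num)]
  have h0 : (0 : ℝ) ≤ n := n.cast_nonneg
  linarith

/-- The supremum of `‖Σ_{k<n} a_k f⁽ᵏ⁾‖_{ℓ²}` over sign patterns `a_k ∈ {−1,0,1}` equals
`√((4/3)n³ − n² + (2/3)n)`, is bounded by `(2/√3) n^{3/2}`, and is attained at the
alternating sign pattern `a_k = (−1)^{k+1}` (i.e. `(−1)^k` in `1`-based indexing). -/
theorem cesaro_dual_sup_sign_combinations (n : ℕ) :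
    sSup {c : ℝ | ∃ a : ℕ → ℝ, (∀ k < n, a k ∈ ({-1, 0, 1} : Set ℝ)) ∧
        c = ‖∑ k ∈ Finset.range n, a k • cesaroDualLp k‖} =
      Real.sqrt ((4 / 3) * (n : ℝ) ^ 3 - (n : ℝ) ^ 2 + (2 / 3) * (n : ℝ)) ∧
    Real.sqrt ((4 / 3) * (n : ℝ) ^ 3 - (n : ℝ) ^ 2 + (2 / 3) * (n : ℝ)) ≤
      (2 / Real.sqrt 3) * (n : ℝ) ^ ((3 : ℝ) / 2) ∧
    ‖∑ k ∈ Finset.range n, ((-1 : ℝ)) ^ (k + 1) • cesaroDualLp k‖ =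
      Real.sqrt ((4 / 3) * (n : ℝ) ^ 3 - (n : ℝ) ^ 2 + (2 / 3) * (n : ℝ)) := by
  refine ⟨IsGreatest.csSup_eq ⟨⟨fun k => (-1 : ℝ) ^ (k + 1), fun k _ => ?_,
    (norm_sum_alternating_smul_cesaroDualLp n).symm⟩, ?_⟩,
    sqrt_cubic_le_rpow n, norm_sum_alternating_smul_cesaroDualLp n⟩
  · rcases neg_one_pow_eq_or ℝ (k + 1) with h | h <;> simp [h]
  · rintro _ ⟨a, ha, rfl⟩
    refine norm_sum_smul_cesaroDualLp_le a n fun k hk => ?_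
    obtain h | h | h : a k = -1 ∨ a k = 0 ∨ a k = 1 := ha k hk <;> simp [h]
end
end

section
/- Let Z₁ and Z₂ be Banach spaces and let B : Z₁ → Z₂ be an injective compact linear operator. Then the range B(Z₁) contains no infinite dimensional closed subspace of Z₂; i.e., every closed subspace M ⊆ Z₂ with M ⊆ B(Z₁) is finite dimensional. -/
noncomputable section

/-- A compact operator between Banach spaces is surjective only onto a finite dimensional space. -/
theorem IsCompactOperator.finiteDimensional_of_surjective
    {𝕜 E F : Type*} [NontriviallyNormedField 𝕜] [CompleteSpace 𝕜]
    [NormedAddCommGroup E] [NormedSpace 𝕜 E] [CompleteSpace E]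
    [NormedAddCommGroup F] [NormedSpace 𝕜 F] [CompleteSpace F]
    {T : E →L[𝕜] F} (hT : IsCompactOperator T) (hsurj : Function.Surjective T) :
    FiniteDimensional 𝕜 F := by
  obtain ⟨K, hK, hK0⟩ := hT
  refine .of_isCompactOperator_id (𝕜 := 𝕜) ⟨K, hK, ?_⟩
  simpa [Set.image_preimage_eq K hsurj] using (T.isOpenMap hsurj).image_mem_nhds hK0

/-- If `B : Z₁ → Z₂` is an injective compact linear operator between Banach spaces, then the
range of `B` contains no infinite dimensional closed subspace: every closed subspace of `Z₂`
contained in the range of `B` is finite dimensional. -/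
theorem compact_injective_range_no_infinite_dim_closed_subspace
    {Z₁ Z₂ : Type*} [NormedAddCommGroup Z₁] [NormedSpace ℝ Z₁] [CompleteSpace Z₁]
    [NormedAddCommGroup Z₂] [NormedSpace ℝ Z₂] [CompleteSpace Z₂]
    (B : Z₁ →L[ℝ] Z₂) (hinj : Function.Injective B) (hcomp : IsCompactOperator B) :
    ∀ M : Submodule ℝ Z₂, IsClosed (M : Set Z₂) → (M : Set Z₂) ⊆ Set.range B →
      FiniteDimensional ℝ M := by
  intro M hM hsub
  have hN : IsClosed (M.comap B.toLinearMap : Set Z₁) := hM.preimage B.continuous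
  have := hM.completeSpace_coe
  have := hN.completeSpace_coe
  let T : M.comap B.toLinearMap →L[ℝ] M :=
    (B.comp (M.comap B.toLinearMap).subtypeL).codRestrict M fun x ↦ x.2
  have hT : IsCompactOperator T :=
    (hcomp.comp_clm (M.comap B.toLinearMap).subtypeL).codRestrict (fun x ↦ x.2) hM
  refine hT.finiteDimensional_of_surjective ?_
  rintro ⟨y, hy⟩
  obtain ⟨x, rfl⟩ := hsub hy
  exact ⟨⟨x, hy⟩, rfl⟩
end
end

section
/- Let H₁ and H₂ be Hilbert spaces and let B : H₁ → H₂ be an injective bounded linear operator whose range B(H₁) is not closed. Then B(H₁) contains an infinite dimensional closed subspace of H₂ if and only if B is not compact. Equivalently: the equation B x = y is ill-posed of type II if and only if B is compact. -/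
noncomputable section

/-- A closed subspace contained in the range of an injective compact operator between Banach
spaces is finite dimensional. -/
theorem IsCompactOperator.finiteDimensional_of_subset_range
    {𝕜 E F : Type*} [NontriviallyNormedField 𝕜] [CompleteSpace 𝕜]
    [NormedAddCommGroup E] [NormedSpace 𝕜 E] [CompleteSpace E]
    [NormedAddCommGroup F] [NormedSpace 𝕜 F] [CompleteSpace F]
    {B : E →L[𝕜] F} (hB : IsCompactOperator B) (hinj : Function.Injective B)
    {M : Submodule 𝕜 F} (hM : IsClosed (M : Set F)) (hsub : (M : Set F) ⊆ Set.range B) :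
    FiniteDimensional 𝕜 M := by
  let N : Submodule 𝕜 E := M.comap B.toLinearMap
  have hN : IsClosed (N : Set E) := hM.preimage B.continuous
  have : CompleteSpace N := hN.completeSpace_coe
  have : CompleteSpace M := hM.completeSpace_coe
  let T : N →L[𝕜] M := (B.comp N.subtypeL).codRestrict M fun x => x.2
  have hTinj : T.ker = ⊥ := LinearMap.ker_eq_bot.mpr fun x y h =>
    Subtype.ext (hinj (congrArg Subtype.val h))
  have hTsurj : T.range = ⊤ := LinearMap.range_eq_top.mpr fun y => by
    obtain ⟨x, hx⟩ := hsub y.2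
    exact ⟨⟨x, by simp [N, hx]⟩, Subtype.ext hx⟩
  have hT : IsCompactOperator T :=
    (hB.comp_clm N.subtypeL).codRestrict (V := M) (fun x => x.2) hM
  let e := ContinuousLinearEquiv.ofBijective T hTinj hTsurj
  refine FiniteDimensional.of_isCompactOperator_id (𝕜 := 𝕜) ?_
  convert! hT.comp_clm (e.symm : M →L[𝕜] N) using 1
  ext y
  exact congrArg Subtype.val (e.apply_symm_apply y).symm

section

variable {𝕜 E F : Type*} [RCLike 𝕜] [NormedAddCommGroup E] [InnerProductSpace 𝕜 E]

/-- A noncompact operator is uniformly large somewhere on the orthogonal complement of every finite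
dimensional subspace. -/
theorem exists_forall_exists_mem_orthogonal_of_not_isCompactOperator
    [NormedAddCommGroup F] [NormedSpace 𝕜 F] [CompleteSpace F]
    {B : E →L[𝕜] F} (hB : ¬ IsCompactOperator B) :
    ∃ ε > 0, ∀ V : Submodule 𝕜 E, FiniteDimensional 𝕜 V → ∃ x ∈ Vᗮ, ε * ‖x‖ < ‖B x‖ := by
  by_contra! h
  refine hB (isClosed_setOfPred_isCompactOperator.closure_subset
    (Metric.mem_closure_iff.mpr fun ε hε => ?_))
  obtain ⟨V, hV, hsmall⟩ := h (ε / 2) (half_pos hε)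
  refine ⟨B.comp V.starProjection, ?_, ?_⟩
  · have : ProperSpace V := FiniteDimensional.proper_rclike 𝕜 V
    exact (isCompactOperator_of_locallyCompactSpace_rng
      (B.comp V.subtypeL)).comp_clm V.orthogonalProjectionOnto
  · rw [dist_eq_norm]
    refine lt_of_le_of_lt (ContinuousLinearMap.opNorm_le_bound _ (half_pos hε).le fun x => ?_)
      (half_lt_self hε)
    have hx : ‖x - V.starProjection x‖ ≤ ‖x‖ := by
      rw [← Submodule.starProjection_orthogonal_val]
      exact Vᗮ.norm_starProjection_apply_le x
    calc ‖(B - B.comp V.starProjection) x‖ = ‖B (x - V.starProjection x)‖ := by simp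
      _ ≤ ε / 2 * ‖x - V.starProjection x‖ := hsmall _ (V.sub_starProjection_mem_orthogonal x)
      _ ≤ ε / 2 * ‖x‖ := by gcongr

/-- **Pythagorean theorem** for finite sums of pairwise orthogonal vectors. -/
theorem norm_sq_sum_of_pairwise_inner_eq_zero {ι : Type*} (s : Finset ι) {v : ι → E}
    (hv : Pairwise fun i j => inner 𝕜 (v i) (v j) = 0) :
    ‖∑ i ∈ s, v i‖ ^ 2 = ∑ i ∈ s, ‖v i‖ ^ 2 := by
  classical
  induction s using Finset.induction_on with
  | empty => simp
  | insert a s ha ih =>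
    have h : inner 𝕜 (v a) (∑ i ∈ s, v i) = 0 := by
      rw [inner_sum]
      exact Finset.sum_eq_zero fun i hi => hv fun hai => ha (hai ▸ hi)
    rw [Finset.sum_insert ha, Finset.sum_insert ha, ← ih, sq, sq, sq,
      norm_add_sq_eq_norm_sq_add_norm_sq_of_inner_eq_zero _ _ h]

variable [NormedAddCommGroup F] [InnerProductSpace 𝕜 F]

/-- If an operator preserves the orthogonality of a family and is bounded below on its members,
then it is bounded below on the closed span of the family. -/
theorem ContinuousLinearMap.le_norm_of_mem_topologicalClosure_span {ι : Type*}
    (B : E →L[𝕜] F) {x : ι → E} {ε : ℝ} (hε : 0 ≤ ε)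
    (hx : Pairwise fun i j => inner 𝕜 (x i) (x j) = 0)
    (hBx : Pairwise fun i j => inner 𝕜 (B (x i)) (B (x j)) = 0)
    (hle : ∀ i, ε * ‖x i‖ ≤ ‖B (x i)‖) {v : E}
    (hv : v ∈ (Submodule.span 𝕜 (Set.range x)).topologicalClosure) :
    ε * ‖v‖ ≤ ‖B v‖ := by
  have hclosed : IsClosed {v : E | ε * ‖v‖ ≤ ‖B v‖} :=
    isClosed_le (by fun_prop) (by fun_prop)
  refine closure_minimal (fun w hw => ?_) hclosed hv
  obtain ⟨c, rfl⟩ := Finsupp.mem_span_range_iff_exists_finsupp.mp hw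
  refine le_of_sq_le_sq ?_ (norm_nonneg _)
  rw [Finsupp.sum, map_sum, mul_pow,
    norm_sq_sum_of_pairwise_inner_eq_zero (𝕜 := 𝕜) (v := fun i => c i • x i) _
      fun i j hij => by simp [inner_smul_left, inner_smul_right, hx hij],
    norm_sq_sum_of_pairwise_inner_eq_zero (𝕜 := 𝕜) (v := fun i => B (c i • x i)) _
      fun i j hij => by simp [inner_smul_left, inner_smul_right, hBx hij], Finset.mul_sum]
  refine Finset.sum_le_sum fun i _ => ?_
  rw [← mul_pow, map_smul, norm_smul, norm_smul, mul_left_comm]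
  gcongr
  exact hle i

variable [CompleteSpace E] [CompleteSpace F]

/-- A noncompact operator between Hilbert spaces is uniformly large on some orthogonal sequence
whose image is again orthogonal. -/
theorem exists_seq_orthogonal_of_not_isCompactOperator
    {B : E →L[𝕜] F} (hB : ¬ IsCompactOperator B) :
    ∃ ε > 0, ∃ x : ℕ → E, (∀ n, ε * ‖x n‖ < ‖B (x n)‖) ∧
      (Pairwise fun m n => inner 𝕜 (x m) (x n) = 0) ∧
      Pairwise fun m n => inner 𝕜 (B (x m)) (B (x n)) = 0 := by
  classical
  obtain ⟨ε, hε, h⟩ := exists_forall_exists_mem_orthogonal_of_not_isCompactOperator hB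
  let r : E → E → Prop := fun x y => inner 𝕜 x y = 0 ∧ inner 𝕜 (B x) (B y) = 0
  have : Std.Symm r := ⟨fun _ _ hxy =>
    ⟨inner_eq_zero_symm.mp hxy.1, inner_eq_zero_symm.mp hxy.2⟩⟩
  obtain ⟨x, hx, hr⟩ := exists_seq_of_forall_finset_exists'
    (fun x => ε * ‖x‖ < ‖B x‖) r fun s _ => by
      obtain ⟨y, hy, hlt⟩ := h
        (Submodule.span 𝕜 (s ∪ s.image fun x => B.adjoint (B x) : Finset E)) inferInstance
      refine ⟨y, hlt, fun x hxs => ⟨hy x (Submodule.subset_span ?_), ?_⟩⟩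
      · exact Finset.mem_union_left _ hxs
      · rw [← ContinuousLinearMap.adjoint_inner_left]
        exact hy _ (Submodule.subset_span
          (Finset.mem_union_right _ (Finset.mem_image_of_mem _ hxs)))
  exact ⟨ε, hε, x, hx, fun m n hmn => (hr hmn).1, fun m n hmn => (hr hmn).2⟩

/-- The range of a noncompact operator between Hilbert spaces contains an infinite dimensional
closed subspace. -/
theorem exists_isClosed_not_finiteDimensional_subset_range
    {B : E →L[𝕜] F} (hB : ¬ IsCompactOperator B) :
    ∃ M : Submodule 𝕜 F, IsClosed (M : Set F) ∧ ¬ FiniteDimensional 𝕜 M ∧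
      (M : Set F) ⊆ Set.range B := by
  obtain ⟨ε, hε, x, hlt, hx, hBx⟩ := exists_seq_orthogonal_of_not_isCompactOperator hB
  let N : Submodule 𝕜 E := (Submodule.span 𝕜 (Set.range x)).topologicalClosure
  have : CompleteSpace N := (Submodule.isClosed_topologicalClosure _).completeSpace_coe
  have hanti : AntilipschitzWith ⟨ε⁻¹, (inv_pos.mpr hε).le⟩ (B.comp N.subtypeL) :=
    ContinuousLinearMap.antilipschitz_of_bound _ fun v => by
      have := B.le_norm_of_mem_topologicalClosure_span hε.le hx hBx (fun n => (hlt n).le) v.2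
      exact (le_inv_mul_iff₀ hε).mpr this
  refine ⟨(B.comp N.subtypeL).range, ?_, fun hfin => ?_, ?_⟩
  · exact hanti.isClosed_range (B.comp N.subtypeL).uniformContinuous
  · have hne : ∀ n, B (x n) ≠ 0 := fun n =>
      norm_pos_iff.mp ((mul_nonneg hε.le (norm_nonneg _)).trans_lt (hlt n))
    have hind : LinearIndependent 𝕜 fun n => B (x n) :=
      linearIndependent_of_ne_zero_of_inner_eq_zero hne hBx
    let y : ℕ → (B.comp N.subtypeL).range := fun n => ⟨B (x n),
      ⟨⟨x n, Submodule.le_topologicalClosure _ (Submodule.subset_span ⟨n, rfl⟩)⟩, rfl⟩⟩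
    have hy : LinearIndependent 𝕜 y := .of_comp (Submodule.subtype _) hind
    exact not_finite_iff_infinite.mpr inferInstance hy.finite
  · rintro _ ⟨v, rfl⟩
    exact ⟨v, rfl⟩

end

/-- For an injective bounded linear operator `B` between Hilbert spaces with nonclosed range,
the range contains an infinite dimensional closed subspace if and only if `B` is not compact.
Equivalently: the equation `B x = y` is ill-posed of type II iff `B` is compact. -/
theorem hilbert_illposed_typeII_iff_compact
    {H₁ H₂ : Type*} [NormedAddCommGroup H₁] [InnerProductSpace ℝ H₁] [CompleteSpace H₁]
    [NormedAddCommGroup H₂] [InnerProductSpace ℝ H₂] [CompleteSpace H₂]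
    (B : H₁ →L[ℝ] H₂) (hinj : Function.Injective B)
    (hrange : ¬ IsClosed (Set.range B)) :
    (∃ M : Submodule ℝ H₂, IsClosed (M : Set H₂) ∧ ¬ FiniteDimensional ℝ M ∧
        (M : Set H₂) ⊆ Set.range B) ↔ ¬ IsCompactOperator B := by
  exact ⟨fun ⟨_, hM, hfin, hsub⟩ hB => hfin (hB.finiteDimensional_of_subset_range hinj hM hsub),
    exists_isClosed_not_finiteDimensional_subset_range⟩
end
end

section
/- Let Z₁ and Z₂ be Banach spaces and let B : Z₁ → Z₂ be an injective bounded linear operator. Then the range B(Z₁) contains an infinite dimensional closed subspace of Z₂ if and only if there exist an infinite dimensional closed subspace M ⊆ Z₁ and a constant c > 0 such that ‖B x‖ ≥ c ‖x‖ for all x ∈ M (i.e., the restriction of B to M is an isomorphism onto its image). Equivalently: the equation B x = y with nonclosed range is ill-posed of type II if and only if B is strictly singular. -/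
/-- An injective bounded operator between Banach spaces has closed image on a closed subspace if
and only if it is bounded below there. -/
theorem isClosed_map_iff_exists_bound_of_injective
    {Z₁ Z₂ : Type*} [NormedAddCommGroup Z₁] [NormedSpace ℝ Z₁] [CompleteSpace Z₁]
    [NormedAddCommGroup Z₂] [NormedSpace ℝ Z₂] [CompleteSpace Z₂]
    (B : Z₁ →L[ℝ] Z₂) (hinj : Function.Injective B)
    (N : Submodule ℝ Z₁) (hN : IsClosed (N : Set Z₁)) :
    IsClosed (B '' (N : Set Z₁)) ↔ ∃ c : ℝ, 0 < c ∧ ∀ x ∈ N, c * ‖x‖ ≤ ‖B x‖ := by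
  have : CompleteSpace N := hN.completeSpace_coe
  have hrange : Set.range (B.comp N.subtypeL) = B '' (N : Set Z₁) := by
    ext y
    simp
  have hinj' : Function.Injective (B.comp N.subtypeL) :=
    hinj.comp Subtype.val_injective
  rw [← hrange]
  constructor
  · intro h
    obtain ⟨K, hanti⟩ :=
      (B.comp N.subtypeL).antilipschitz_of_injective_of_isClosed_range hinj' h
    have hK : (0 : ℝ) < K + 1 := by positivity
    refine ⟨((K : ℝ) + 1)⁻¹, inv_pos.2 hK, fun x hx => ?_⟩
    have hx' : ‖x‖ ≤ K * ‖B x‖ := by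
      simpa using hanti.le_mul_norm (map_zero _) (⟨x, hx⟩ : N)
    rw [inv_mul_le_iff₀ hK]
    linarith [norm_nonneg (B x)]
  · rintro ⟨c, hc, hbound⟩
    have hanti : AntilipschitzWith (Real.toNNReal c⁻¹) (B.comp N.subtypeL) := by
      refine AddMonoidHomClass.antilipschitz_of_bound _ fun x => ?_
      rw [Real.coe_toNNReal _ (inv_pos.2 hc).le, ← div_eq_inv_mul, le_div_iff₀' hc]
      exact hbound x x.2
    exact hanti.isClosed_range (B.comp N.subtypeL).uniformContinuous


noncomputable section

/-- For an injective bounded linear operator `B` between Banach spaces, the range of `B`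
contains an infinite dimensional closed subspace of `Z₂` if and only if there are an infinite
dimensional closed subspace `N ⊆ Z₁` and `c > 0` with `‖B x‖ ≥ c ‖x‖` on `N` (i.e. the
restriction of `B` to `N` is an isomorphism onto its image). Equivalently: the equation
`B x = y` with nonclosed range is ill-posed of type II iff `B` is strictly singular. -/
theorem range_infinite_dim_closed_subspace_iff_not_strictly_singular
    {Z₁ Z₂ : Type*} [NormedAddCommGroup Z₁] [NormedSpace ℝ Z₁] [CompleteSpace Z₁]
    [NormedAddCommGroup Z₂] [NormedSpace ℝ Z₂] [CompleteSpace Z₂]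
    (B : Z₁ →L[ℝ] Z₂) (hinj : Function.Injective B) :
    (∃ M : Submodule ℝ Z₂, IsClosed (M : Set Z₂) ∧ ¬ FiniteDimensional ℝ M ∧
        (M : Set Z₂) ⊆ Set.range B) ↔
      (∃ N : Submodule ℝ Z₁, IsClosed (N : Set Z₁) ∧ ¬ FiniteDimensional ℝ N ∧
        ∃ c : ℝ, 0 < c ∧ ∀ x ∈ N, c * ‖x‖ ≤ ‖B x‖) := by
  constructor
  · rintro ⟨M, hM, hdim, hsub⟩
    have himage : B '' (M.comap B.toLinearMap : Set Z₁) = M :=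
      Set.image_preimage_eq_of_subset hsub
    have hN : IsClosed (M.comap B.toLinearMap : Set Z₁) := hM.preimage B.continuous
    refine ⟨M.comap B.toLinearMap, hN, fun hfin => hdim ?_,
      (isClosed_map_iff_exists_bound_of_injective B hinj _ hN).1 (himage.symm ▸ hM)⟩
    have hmap : (M.comap B.toLinearMap).map B.toLinearMap = M := SetLike.coe_injective himage
    rw [← hmap]
    infer_instance
  · rintro ⟨N, hN, hdim, hbound⟩
    refine ⟨N.map B.toLinearMap,
      (isClosed_map_iff_exists_bound_of_injective B hinj N hN).2 hbound, fun hfin => hdim ?_,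
      Set.image_subset_range B N⟩
    exact (N.equivMapOfInjective B.toLinearMap hinj).symm.finiteDimensional
end
end
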